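/- Let G be a countable group acting ergodically by measure-preserving Borel bijections on a standard probability space (X, μ), and let A, B ⊆ X be Borel sets with 0 < μ(A) ≤ μ(B). Then there exists a σ_G({A, B})-expressible element θ of the pseudo-group [[E_G^X]] with dom(θ) = A (up to a μ-null set) and rng(θ) ⊆ B; that is, there is a partition {Z_g : g ∈ G} of A (mod null) into sets measurable with respect to σ_G({A, B}) such that the map θ defined by θ(x) = g·x for x ∈ Z_g is an injection of A into B. -/

import Mathlib

open MeasureTheory Real ENNReal

section Defs

variable {X : Type*} {mX : MeasurableSpace X}

/-- The smallest `G`-invariant sub-σ-algebra containing the collection `C`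
(together with `X`) and all `μ`-null sets. -/
def sigmaG (G : Type*) [Group G] [MulAction G X] (μ : Measure X) (C : Set (Set X)) :
    MeasurableSpace X :=
  sInf {m : MeasurableSpace X |
    (∀ S ∈ C, MeasurableSet[m] S) ∧
    (∀ S : Set X, MeasurableSet[m] S → ∀ g : G, MeasurableSet[m] ((fun x => g • x) ⁻¹' S)) ∧
    (∀ S : Set X, μ S = 0 → MeasurableSet[m] S)}

/-- The action of `G` on `(X, μ)` is by measure-preserving (Borel) bijections. -/
def IsPmpAction (G : Type*) [Group G] [MulAction G X] (μ : Measure X) : Prop :=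
  ∀ g : G, @MeasurePreserving X X mX mX (fun x : X => g • x) μ μ

/-- The action is ergodic: every `G`-invariant Borel set is null or conull. -/
def IsErgodicAction (G : Type*) [Group G] [MulAction G X] (μ : Measure X) : Prop :=
  ∀ A : Set X, MeasurableSet[mX] A → (∀ g : G, (fun x => g • x) ⁻¹' A = A) →
    μ A = 0 ∨ μ A = 1

/-- A countable Borel partition (as an indexed family): measurable, pairwise
disjoint sets whose union is conull. -/
def IsPartition {ι : Type*} (μ : Measure X) (A : ι → Set X) : Prop :=
  (∀ i, MeasurableSet[mX] (A i)) ∧ Pairwise (Function.onFun Disjoint A) ∧ μ (⋃ i, A i) = 1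

/-- The partition is generating: `σ_G(A)` is the full Borel σ-algebra (up to null
sets; `σ_G(A)` contains all null sets, so this is containment of the Borel sets). -/
def IsGenerating (G : Type*) [Group G] [MulAction G X] {ι : Type*} (μ : Measure X)
    (A : ι → Set X) : Prop :=
  mX ≤ sigmaG G μ (Set.range A)

/-- Shannon entropy of a countable partition, valued in `ℝ≥0∞`. -/
noncomputable def partitionEntropy {ι : Type*} (μ : Measure X) (A : ι → Set X) : ℝ≥0∞ :=
  ∑' i, ENNReal.ofReal (negMulLog (μ (A i)).toReal)

/-- Shannon entropy of a (finite or countable) probability vector, valued in `ℝ≥0∞`. -/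
noncomputable def vecEntropy {ι : Type*} (p : ι → ℝ) : ℝ≥0∞ :=
  ∑' i, ENNReal.ofReal (negMulLog (p i))

/-- Rokhlin entropy: the infimum of the Shannon entropies of countable Borel
generating partitions. -/
noncomputable def rokhlinEntropy (G : Type*) [Group G] [MulAction G X] (μ : Measure X) :
    ℝ≥0∞ :=
  ⨅ (A : ℕ → Set X) (_ : IsPartition μ A ∧ IsGenerating G μ A), partitionEntropy μ A

end Defs

section Greedy

variable {X G : Type*} [Group G] [MulAction G X]

/-- The parts of `A` and of `B` that are still unmatched after the group elements
`e 0, …, e (n - 1)` have been used greedily to match points of `A` with points of `B`. -/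
def greedyRemainder (e : ℕ → G) (A B : Set X) : ℕ → Set X × Set X
  | 0 => (A, B)
  | n + 1 =>
    let P := greedyRemainder e A B n
    (P.1 \ (fun x => e n • x) ⁻¹' P.2, P.2 \ (fun x => (e n)⁻¹ • x) ⁻¹' P.1)

/-- The set of points of `A` matched at stage `n` by the element `e n`. -/
def greedySource (e : ℕ → G) (A B : Set X) (n : ℕ) : Set X :=
  (greedyRemainder e A B n).1 ∩ (fun x => e n • x) ⁻¹' (greedyRemainder e A B n).2

/-- The set of points of `B` matched at stage `n` by the element `e n`. -/
def greedyTarget (e : ℕ → G) (A B : Set X) (n : ℕ) : Set X :=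
  (greedyRemainder e A B n).2 ∩ (fun x => (e n)⁻¹ • x) ⁻¹' (greedyRemainder e A B n).1

variable (e : ℕ → G) (A B : Set X)

lemma greedyRemainder_fst_succ (n : ℕ) :
    (greedyRemainder e A B (n + 1)).1 = (greedyRemainder e A B n).1 \ greedySource e A B n := by
  ext x
  simp [greedyRemainder, greedySource]

lemma greedyRemainder_snd_succ (n : ℕ) :
    (greedyRemainder e A B (n + 1)).2 = (greedyRemainder e A B n).2 \ greedyTarget e A B n := by
  ext x
  simp [greedyRemainder, greedyTarget]

lemma preimage_greedyTarget (n : ℕ) :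
    (fun x => e n • x) ⁻¹' greedyTarget e A B n = greedySource e A B n := by
  ext x
  simp [greedyTarget, greedySource, and_comm]

/-- Successive removal of sets `S n ⊆ R n` leaves antitone remainders and disjoint pieces. -/
lemma pairwise_disjoint_of_succ_eq_diff {R S : ℕ → Set X} (hS : ∀ n, S n ⊆ R n)
    (hR : ∀ n, R (n + 1) = R n \ S n) : Pairwise (Function.onFun Disjoint S) := by
  have hanti : Antitone R := antitone_nat_of_succ_le fun n => by
    rw [hR n]
    exact Set.sdiff_subset
  refine (pairwise_disjoint_on S).2 fun m n hmn => Set.disjoint_left.2 fun x hx hx' => ?_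
  have h := hanti (Nat.succ_le_of_lt hmn) (hS n hx')
  rw [Nat.succ_eq_add_one, hR m] at h
  exact h.2 hx

lemma mem_of_notMem_iUnion {R S : ℕ → Set X} (hR : ∀ n, R (n + 1) = R n \ S n) {x : X}
    (h0 : x ∈ R 0) (hx : x ∉ ⋃ n, S n) (n : ℕ) : x ∈ R n := by
  induction n with
  | zero => exact h0
  | succ n ih =>
    rw [hR n]
    exact ⟨ih, fun h => hx (Set.mem_iUnion.2 ⟨n, h⟩)⟩

lemma subset_zero_of_succ_eq_diff {R S : ℕ → Set X} (hS : ∀ n, S n ⊆ R n)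
    (hR : ∀ n, R (n + 1) = R n \ S n) (n : ℕ) : S n ⊆ R 0 := by
  have hanti : Antitone R := antitone_nat_of_succ_le fun n => by
    rw [hR n]
    exact Set.sdiff_subset
  exact (hS n).trans (hanti n.zero_le)

lemma pairwise_disjoint_greedySource :
    Pairwise (Function.onFun Disjoint (greedySource e A B)) :=
  pairwise_disjoint_of_succ_eq_diff (fun _ => Set.inter_subset_left)
    (greedyRemainder_fst_succ e A B)

lemma pairwise_disjoint_greedyTarget :
    Pairwise (Function.onFun Disjoint (greedyTarget e A B)) :=
  pairwise_disjoint_of_succ_eq_diff (fun _ => Set.inter_subset_left)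
    (greedyRemainder_snd_succ e A B)

lemma greedySource_subset (n : ℕ) : greedySource e A B n ⊆ A :=
  subset_zero_of_succ_eq_diff (R := fun n => (greedyRemainder e A B n).1)
    (fun _ => Set.inter_subset_left) (greedyRemainder_fst_succ e A B) n

lemma greedyTarget_subset (n : ℕ) : greedyTarget e A B n ⊆ B :=
  subset_zero_of_succ_eq_diff (R := fun n => (greedyRemainder e A B n).2)
    (fun _ => Set.inter_subset_left) (greedyRemainder_snd_succ e A B) n

lemma smul_mem_greedyTarget {n : ℕ} {x : X} (hx : x ∈ greedySource e A B n) :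
    e n • x ∈ greedyTarget e A B n := by
  rwa [← preimage_greedyTarget] at hx

/-- No element of the sequence moves an unmatched point of `A` to an unmatched point of `B`. -/
lemma smul_notMem_of_unmatched {x : X} (hx : x ∈ A \ ⋃ n, greedySource e A B n) (n : ℕ) :
    e n • x ∉ B \ ⋃ n, greedyTarget e A B n := fun h =>
  hx.2 <| Set.mem_iUnion.2 ⟨n,
    mem_of_notMem_iUnion (R := fun n => (greedyRemainder e A B n).1)
      (greedyRemainder_fst_succ e A B) hx.1 hx.2 n,
    mem_of_notMem_iUnion (R := fun n => (greedyRemainder e A B n).2)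
      (greedyRemainder_snd_succ e A B) h.1 h.2 n⟩

variable {A B}

lemma measurableSet_greedyRemainder (m : MeasurableSpace X)
    (hm : ∀ S : Set X, MeasurableSet[m] S → ∀ g : G, MeasurableSet[m] ((fun x => g • x) ⁻¹' S))
    (hA : MeasurableSet[m] A) (hB : MeasurableSet[m] B) (n : ℕ) :
    MeasurableSet[m] (greedyRemainder e A B n).1 ∧
      MeasurableSet[m] (greedyRemainder e A B n).2 := by
  induction n with
  | zero => exact ⟨hA, hB⟩
  | succ n ih => exact ⟨ih.1.diff (hm _ ih.2 _), ih.2.diff (hm _ ih.1 _)⟩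

lemma measurableSet_greedySource (m : MeasurableSpace X)
    (hm : ∀ S : Set X, MeasurableSet[m] S → ∀ g : G, MeasurableSet[m] ((fun x => g • x) ⁻¹' S))
    (hA : MeasurableSet[m] A) (hB : MeasurableSet[m] B) (n : ℕ) :
    MeasurableSet[m] (greedySource e A B n) :=
  have h := measurableSet_greedyRemainder e m hm hA hB n
  h.1.inter (hm _ h.2 _)

lemma measurableSet_greedyTarget (m : MeasurableSpace X)
    (hm : ∀ S : Set X, MeasurableSet[m] S → ∀ g : G, MeasurableSet[m] ((fun x => g • x) ⁻¹' S))
    (hA : MeasurableSet[m] A) (hB : MeasurableSet[m] B) (n : ℕ) :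
    MeasurableSet[m] (greedyTarget e A B n) :=
  have h := measurableSet_greedyRemainder e m hm hA hB n
  h.2.inter (hm _ h.1 _)

end Greedy

section SigmaG

variable {X : Type*} {mX : MeasurableSpace X} {G : Type*} [Group G] [MulAction G X]
  {μ : Measure X} {C : Set (Set X)}

lemma measurableSet_sigmaG_of_mem {S : Set X} (hS : S ∈ C) : MeasurableSet[sigmaG G μ C] S :=
  MeasurableSpace.measurableSet_sInf.2 fun _ hm => hm.1 S hS

lemma measurableSet_sigmaG_preimage_smul {S : Set X} (hS : MeasurableSet[sigmaG G μ C] S) (g : G) :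
    MeasurableSet[sigmaG G μ C] ((fun x => g • x) ⁻¹' S) :=
  MeasurableSpace.measurableSet_sInf.2 fun m hm =>
    hm.2.1 S (MeasurableSpace.measurableSet_sInf.1 hS m hm) g

/-- In an ergodic p.m.p. action, a set of positive measure has conull saturation. -/
lemma measure_eq_zero_of_forall_smul_notMem [Countable G] [IsProbabilityMeasure μ]
    (hpmp : IsPmpAction G μ) (herg : IsErgodicAction G μ) {S T : Set X}
    (hS : MeasurableSet S) (hST : ∀ g : G, ∀ x ∈ S, g • x ∉ T) (hpos : μ S ≠ 0) : μ T = 0 := by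
  set U : Set X := ⋃ g : G, (fun x => g • x) ⁻¹' S with hU
  have hUm : MeasurableSet U := MeasurableSet.iUnion fun g => (hpmp g).measurable hS
  have hinv : ∀ g : G, (fun x => g • x) ⁻¹' U = U := fun g => by
    ext x
    simp only [hU, Set.mem_preimage, Set.mem_iUnion, smul_smul]
    exact (Equiv.mulRight g).exists_congr_left.trans (by simp)
  have hSU : S ⊆ U := fun x hx => Set.mem_iUnion.2 ⟨1, by simpa using hx⟩
  have hU1 : μ U = 1 := (herg U hUm hinv).resolve_left fun h => hpos (measure_mono_null hSU h)
  refine measure_mono_null (t := Uᶜ) (fun y hy hyU => ?_) ((prob_compl_eq_zero_iff hUm).2 hU1)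
  obtain ⟨g, hg⟩ := Set.mem_iUnion.1 hyU
  exact hST g⁻¹ _ hg (by simpa using hy)

lemma measure_greedyTarget (hpmp : IsPmpAction G μ) (e : ℕ → G) {A B : Set X}
    (hA : MeasurableSet A) (hB : MeasurableSet B) (n : ℕ) :
    μ (greedyTarget e A B n) = μ (greedySource e A B n) := by
  rw [← preimage_greedyTarget, (hpmp (e n)).measure_preimage]
  exact (measurableSet_greedyTarget e mX (fun _ hS g => (hpmp g).measurable hS)
    hA hB n).nullMeasurableSet

/-- If `μ A ≤ μ B`, greedy matching along an enumeration of `G` exhausts `A` up to a null set. -/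
lemma measure_diff_iUnion_greedySource [Countable G] [IsProbabilityMeasure μ]
    (hpmp : IsPmpAction G μ) (herg : IsErgodicAction G μ) {e : ℕ → G}
    (he : Function.Surjective e) {A B : Set X}
    (hA : MeasurableSet A) (hB : MeasurableSet B) (hAB : μ A ≤ μ B) :
    μ (A \ ⋃ n, greedySource e A B n) = 0 := by
  have hmX : ∀ S : Set X, MeasurableSet S → ∀ g : G, MeasurableSet ((fun x => g • x) ⁻¹' S) :=
    fun _ hS g => (hpmp g).measurable hS
  have hSm := measurableSet_greedySource e mX hmX hA hB
  have hTm := measurableSet_greedyTarget e mX hmX hA hB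
  have hSU := MeasurableSet.iUnion hSm
  have hTU := MeasurableSet.iUnion hTm
  by_contra hne
  have hrest : μ (B \ ⋃ n, greedyTarget e A B n) = 0 :=
    measure_eq_zero_of_forall_smul_notMem hpmp herg (hA.diff hSU)
      (fun g x hx => by
        obtain ⟨n, rfl⟩ := he g
        exact smul_notMem_of_unmatched e A B hx n) hne
  have heq : μ (⋃ n, greedyTarget e A B n) = μ (⋃ n, greedySource e A B n) := by
    rw [measure_iUnion (pairwise_disjoint_greedyTarget e A B) hTm,
      measure_iUnion (pairwise_disjoint_greedySource e A B) hSm]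
    exact tsum_congr (measure_greedyTarget hpmp e hA hB)
  apply hne
  rw [measure_sdiff (Set.iUnion_subset (greedySource_subset e A B)) hSU.nullMeasurableSet
    (measure_ne_top μ _), tsub_eq_zero_iff_le, ← heq]
  exact hAB.trans (measure_mono_ae (ae_le_set.2 hrest))

end SigmaG

/-- **Lemma (exhaustion lemma).** For Borel sets `A, B` with
`0 < μ(A) ≤ μ(B)` there is a `σ_G({A,B})`-expressible element `θ` of the
pseudo-group with `dom(θ) = A` (mod null) and `rng(θ) ⊆ B`: there is a
`σ_G({A,B})`-measurable partition `{Z_g}` of `A` (mod null) such that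
`θ(x) = g • x` for `x ∈ Z_g` defines an injection of `A` into `B`. -/
theorem exists_expressible_injection
    {X : Type*} [mX : MeasurableSpace X] [StandardBorelSpace X]
    (G : Type*) [Group G] [Countable G] [MulAction G X]
    (μ : Measure X) [IsProbabilityMeasure μ]
    (hpmp : IsPmpAction G μ) (herg : IsErgodicAction G μ)
    (A B : Set X) (hA : MeasurableSet[mX] A) (hB : MeasurableSet[mX] B)
    (h0 : 0 < μ A) (hAB : μ A ≤ μ B) :
    ∃ Z : G → Set X,
      (∀ g, MeasurableSet[sigmaG G μ {A, B}] (Z g)) ∧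
      (∀ g, Z g ⊆ A) ∧
      Pairwise (Function.onFun Disjoint Z) ∧
      μ (A \ ⋃ g, Z g) = 0 ∧
      (∀ g, ∀ x ∈ Z g, g • x ∈ B) ∧
      (∀ g g' : G, ∀ x ∈ Z g, ∀ x' ∈ Z g', g • x = g' • x' → x = x') := by
  obtain ⟨e, he⟩ := exists_surjective_nat G
  have hmem : ∀ g x, x ∈ (⋃ (n : ℕ) (_ : e n = g), greedySource e A B n) ↔
      ∃ n, e n = g ∧ x ∈ greedySource e A B n := by
    simp
  refine ⟨fun g => ⋃ (n : ℕ) (_ : e n = g), greedySource e A B n, fun g => ?_, fun g => ?_,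
    fun g g' hgg' => ?_, ?_, fun g x hx => ?_, fun g g' x hx x' hx' hxx' => ?_⟩
  · exact MeasurableSet.iUnion fun n => MeasurableSet.iUnion fun _ =>
      measurableSet_greedySource e _ (fun _ hS g => measurableSet_sigmaG_preimage_smul hS g)
        (measurableSet_sigmaG_of_mem (by simp)) (measurableSet_sigmaG_of_mem (by simp)) n
  · exact Set.iUnion₂_subset fun n _ => greedySource_subset e A B n
  · refine Set.disjoint_left.2 fun x hx hx' => ?_
    obtain ⟨n, rfl, hn⟩ := (hmem g x).1 hx
    obtain ⟨n', rfl, hn'⟩ := (hmem g' x).1 hx'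
    have hnn' : n ≠ n' := fun h => hgg' (congrArg e h)
    exact Set.disjoint_left.1 (pairwise_disjoint_greedySource e A B hnn') hn hn'
  · refine measure_mono_null (Set.sdiff_subset_sdiff_right (Set.iUnion_subset fun n x hn => ?_))
      (measure_diff_iUnion_greedySource hpmp herg he hA hB hAB)
    exact Set.mem_iUnion.2 ⟨e n, (hmem _ x).2 ⟨n, rfl, hn⟩⟩
  · obtain ⟨n, rfl, hn⟩ := (hmem g x).1 hx
    exact greedyTarget_subset e A B n (smul_mem_greedyTarget e A B hn)
  · obtain ⟨n, rfl, hn⟩ := (hmem g x).1 hx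
    obtain ⟨n', rfl, hn'⟩ := (hmem g' x').1 hx'
    have h := smul_mem_greedyTarget e A B hn
    have h' := smul_mem_greedyTarget e A B hn'
    have hnn' : n = n' := by
      by_contra hne
      exact Set.disjoint_left.1 (pairwise_disjoint_greedyTarget e A B hne) h (hxx' ▸ h')
    subst hnn'
    exact MulAction.injective _ hxx'
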